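/- For every α ∈ ℝ, β > 0, μ ∈ ℝ and σ > 0, the set S(α, β, μ, σ) has a greatest element and a least element; moreover, if μ₁ < μ₂ then the greatest element of S(α, β, μ₂, σ) is strictly less than the greatest element of S(α, β, μ₁, σ), and the least element of S(α, β, μ₂, σ) is strictly less than the least element of S(α, β, μ₁, σ). -/

import Mathlib

open Real MeasureTheory

/-- The standard normal cumulative distribution function
`Φ(z) = (1/√(2π)) ∫_{−∞}^{z} exp(−t²/2) dt`. -/
noncomputable def stdNormalCDF (z : ℝ) : ℝ :=
  (Real.sqrt (2 * Real.pi))⁻¹ * ∫ t in Set.Iic z, Real.exp (-t ^ 2 / 2)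

/-- The equilibrium solution set `S(α, β, μ, σ) = {θ : α + β·θ = Φ((θ − μ)/σ)}`. -/
def S (α β μ σ : ℝ) : Set ℝ :=
  {θ : ℝ | α + β * θ = stdNormalCDF ((θ - μ) / σ)}

theorem integrable_exp_neg_sq_div_two : Integrable fun t : ℝ => Real.exp (-t ^ 2 / 2) := by
  convert integrable_exp_neg_mul_sq (b := 1 / 2) (by norm_num) using 3
  ring

theorem stdNormalCDF_nonneg (z : ℝ) : 0 ≤ stdNormalCDF z :=
  mul_nonneg (by positivity) (integral_nonneg fun _ => (Real.exp_pos _).le)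

theorem stdNormalCDF_le (z : ℝ) :
    stdNormalCDF z ≤ (Real.sqrt (2 * Real.pi))⁻¹ * ∫ t : ℝ, Real.exp (-t ^ 2 / 2) :=
  mul_le_mul_of_nonneg_left
    (setIntegral_le_integral integrable_exp_neg_sq_div_two
      (Filter.Eventually.of_forall fun _ => (Real.exp_pos _).le))
    (by positivity)

theorem stdNormalCDF_sub (a b : ℝ) : stdNormalCDF b - stdNormalCDF a =
    (Real.sqrt (2 * Real.pi))⁻¹ * ∫ t in a..b, Real.exp (-t ^ 2 / 2) := by
  rw [stdNormalCDF, stdNormalCDF, ← mul_sub, intervalIntegral.integral_Iic_sub_Iic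
    integrable_exp_neg_sq_div_two.integrableOn integrable_exp_neg_sq_div_two.integrableOn]

theorem strictMono_stdNormalCDF : StrictMono stdNormalCDF := fun a b hab => by
  have hpos : 0 < ∫ t in a..b, Real.exp (-t ^ 2 / 2) :=
    intervalIntegral.intervalIntegral_pos_of_pos
      (integrable_exp_neg_sq_div_two.intervalIntegrable) (fun _ => Real.exp_pos _) hab
  rw [← sub_pos, stdNormalCDF_sub]
  positivity

theorem continuous_stdNormalCDF : Continuous stdNormalCDF := by
  have h : stdNormalCDF = fun z => stdNormalCDF 0 +
      (Real.sqrt (2 * Real.pi))⁻¹ * ∫ t in (0 : ℝ)..z, Real.exp (-t ^ 2 / 2) := by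
    funext z
    rw [← stdNormalCDF_sub, add_sub_cancel]
  rw [h]
  exact continuous_const.add (continuous_const.mul (intervalIntegral.continuous_primitive
    (fun _ _ => integrable_exp_neg_sq_div_two.intervalIntegrable) 0))

theorem continuous_stdNormalCDF_comp (μ σ : ℝ) :
    Continuous fun θ : ℝ => stdNormalCDF ((θ - μ) / σ) :=
  continuous_stdNormalCDF.comp ((continuous_id.sub continuous_const).div_const σ)

theorem exists_mem_S_ge {α β μ σ x : ℝ} (hβ : 0 < β)
    (hx : α + β * x ≤ stdNormalCDF ((x - μ) / σ)) : ∃ y ∈ S α β μ σ, x ≤ y := by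
  set C := (Real.sqrt (2 * Real.pi))⁻¹ * ∫ t : ℝ, Real.exp (-t ^ 2 / 2)
  have hxC : x ≤ (C - α) / β := by
    rw [le_div_iff₀ hβ]
    linarith [stdNormalCDF_le ((x - μ) / σ)]
  have hC : stdNormalCDF (((C - α) / β - μ) / σ) ≤ α + β * ((C - α) / β) := by
    rw [mul_div_cancel₀ _ hβ.ne', add_sub_cancel]
    exact stdNormalCDF_le _
  obtain ⟨y, hy, h⟩ := isPreconnected_Icc.intermediate_value₂
    (Set.left_mem_Icc.2 hxC) (Set.right_mem_Icc.2 hxC)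
    (by fun_prop : Continuous fun θ : ℝ => α + β * θ).continuousOn
    (continuous_stdNormalCDF_comp μ σ).continuousOn hx hC
  exact ⟨y, h, hy.1⟩

theorem exists_mem_S_le {α β μ σ x : ℝ} (hβ : 0 < β)
    (hx : stdNormalCDF ((x - μ) / σ) ≤ α + β * x) : ∃ y ∈ S α β μ σ, y ≤ x := by
  have hx0 : -α / β ≤ x := by
    rw [div_le_iff₀ hβ]
    linarith [stdNormalCDF_nonneg ((x - μ) / σ)]
  have h0 : α + β * (-α / β) ≤ stdNormalCDF ((-α / β - μ) / σ) := by
    rw [mul_div_cancel₀ _ hβ.ne', add_neg_cancel]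
    exact stdNormalCDF_nonneg _
  obtain ⟨y, hy, h⟩ := isPreconnected_Icc.intermediate_value₂
    (Set.left_mem_Icc.2 hx0) (Set.right_mem_Icc.2 hx0)
    (by fun_prop : Continuous fun θ : ℝ => α + β * θ).continuousOn
    (continuous_stdNormalCDF_comp μ σ).continuousOn h0 hx
  exact ⟨y, h, hy.2⟩

theorem S_nonempty {α β : ℝ} (hβ : 0 < β) (μ σ : ℝ) : (S α β μ σ).Nonempty := by
  obtain h | h := le_total (α + β * 0) (stdNormalCDF ((0 - μ) / σ))
  · obtain ⟨y, hy, -⟩ := exists_mem_S_ge hβ h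
    exact ⟨y, hy⟩
  · obtain ⟨y, hy, -⟩ := exists_mem_S_le hβ h
    exact ⟨y, hy⟩

theorem isCompact_S {α β : ℝ} (hβ : 0 < β) (μ σ : ℝ) : IsCompact (S α β μ σ) := by
  refine (isCompact_Icc (a := -α / β)
    (b := ((Real.sqrt (2 * Real.pi))⁻¹ * (∫ t : ℝ, Real.exp (-t ^ 2 / 2)) - α) / β)).of_isClosed_subset
    (isClosed_eq (by fun_prop) (continuous_stdNormalCDF_comp μ σ)) fun θ hθ => ?_
  have hθ' : α + β * θ = stdNormalCDF ((θ - μ) / σ) := hθ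
  rw [Set.mem_Icc, div_le_iff₀ hβ, le_div_iff₀ hβ]
  constructor
  · linarith [stdNormalCDF_nonneg ((θ - μ) / σ)]
  · linarith [stdNormalCDF_le ((θ - μ) / σ)]

theorem stdNormalCDF_sub_div_lt {μ₁ μ₂ σ : ℝ} (hσ : 0 < σ) (hμ : μ₁ < μ₂) (θ : ℝ) :
    stdNormalCDF ((θ - μ₂) / σ) < stdNormalCDF ((θ - μ₁) / σ) :=
  strictMono_stdNormalCDF (div_lt_div_of_pos_right (by linarith) hσ)

/-- Proposition 3(iii): `S(α, β, μ, σ)` always has a greatest element (the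
high-protest equilibrium) and a least element (the low-protest equilibrium),
and both are strictly decreasing in the interim belief `μ`. -/
theorem stmt13 (α β σ : ℝ) (hβ : 0 < β) (hσ : 0 < σ) :
    (∀ μ : ℝ, (∃ θ, IsGreatest (S α β μ σ) θ) ∧ (∃ θ, IsLeast (S α β μ σ) θ)) ∧
    (∀ μ₁ μ₂ g₁ g₂ l₁ l₂ : ℝ, μ₁ < μ₂ →
      IsGreatest (S α β μ₁ σ) g₁ → IsGreatest (S α β μ₂ σ) g₂ →
      IsLeast (S α β μ₁ σ) l₁ → IsLeast (S α β μ₂ σ) l₂ →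
      g₂ < g₁ ∧ l₂ < l₁) := by
  refine ⟨fun μ => ⟨(isCompact_S hβ μ σ).exists_isGreatest (S_nonempty hβ μ σ),
    (isCompact_S hβ μ σ).exists_isLeast (S_nonempty hβ μ σ)⟩, ?_⟩
  intro μ₁ μ₂ g₁ g₂ l₁ l₂ hμ hg₁ hg₂ hl₁ hl₂
  have hg : α + β * g₂ < stdNormalCDF ((g₂ - μ₁) / σ) :=
    hg₂.1.trans_lt (stdNormalCDF_sub_div_lt hσ hμ g₂)
  have hl : stdNormalCDF ((l₁ - μ₂) / σ) < α + β * l₁ :=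
    (stdNormalCDF_sub_div_lt hσ hμ l₁).trans_eq hl₁.1.symm
  constructor
  · obtain ⟨y, hy, hle⟩ := exists_mem_S_ge hβ hg.le
    refine (hle.trans (hg₁.2 hy)).lt_of_ne ?_
    rintro rfl
    exact hg.ne hg₁.1
  · obtain ⟨y, hy, hle⟩ := exists_mem_S_le hβ hl.le
    refine ((hl₂.2 hy).trans hle).lt_of_ne ?_
    rintro rfl
    exact hl.ne' hl₂.1
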